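/- Fix λ > 0 and c > 0. For (τ, ν) ∈ ℝ² set r² = τ² + ν² and define k(τ, ν) = [ λ^{3/2}·c·ν·(4c − 2τ² − ν²) − 4√λ·c·ν − τ·(4τ² + λ·(4c² − 4cτ² + τ⁴ + τ²ν²)) ] / [ √λ·c·(4r² + λ·(2c − r²)²) ]. Then there is no point (τ, ν) ∈ ℝ² with 1 + k(τ, ν)·ν = 0 and k(τ, ν)·τ = 0. In other words, the planar vector field (τ, ν) ↦ (1 + k(τ,ν)·ν, −k(τ,ν)·τ) has no equilibrium points. -/

import Mathlib

open Real

/-- The curvature function of the planar curve generating a helicoidal vertical translator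
with pitch `c` in the Heisenberg group `(Nil₃, g_λ)`, expressed in terms of the support
functions `τ = ⟨γ, T⟩` and `ν = ⟨γ, N⟩`. -/
noncomputable def helicoidalCurvature (lam c τ ν : ℝ) : ℝ :=
  ((Real.sqrt lam) ^ 3 * c * ν * (4 * c - 2 * τ ^ 2 - ν ^ 2) - 4 * Real.sqrt lam * c * ν -
      τ * (4 * τ ^ 2 + lam * (4 * c ^ 2 - 4 * c * τ ^ 2 + τ ^ 4 + τ ^ 2 * ν ^ 2))) /
    (Real.sqrt lam * c * (4 * (τ ^ 2 + ν ^ 2) + lam * (2 * c - (τ ^ 2 + ν ^ 2)) ^ 2))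

/-- The autonomous system `τ' = 1 + kν`, `ν' = −kτ` generating helicoidal vertical
translators in `(Nil₃, g_λ)` has no equilibrium points. -/
theorem helicoidal_no_equilibrium_points
    (lam c : ℝ) (hlam : 0 < lam) (hc : 0 < c) :
    ¬ ∃ τ ν : ℝ, 1 + helicoidalCurvature lam c τ ν * ν = 0 ∧
      helicoidalCurvature lam c τ ν * τ = 0 := by
  rintro ⟨τ, ν, h₁, h₂⟩
  obtain hk | rfl := mul_eq_zero.mp h₂
  · simp [hk] at h₁
  have hν : ν ≠ 0 := by
    rintro rfl
    simp at h₁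
  have hs : 0 < √lam := Real.sqrt_pos.mpr hlam
  have hsq : √lam ^ 2 = lam := Real.sq_sqrt hlam.le
  have hD : 0 < √lam * c * (4 * (0 ^ 2 + ν ^ 2) + lam * (2 * c - (0 ^ 2 + ν ^ 2)) ^ 2) := by
    positivity
  rw [helicoidalCurvature, div_mul_eq_mul_div, ← div_self hD.ne', ← add_div,
    div_eq_zero_iff, or_iff_left hD.ne'] at h₁
  have hpos : 0 < 4 * √lam ^ 3 * c ^ 3 := by positivity
  refine hpos.ne' (Eq.trans ?_ h₁)
  linear_combination √lam * c * (2 * c - ν ^ 2) ^ 2 * hsq
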